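/- Let A be a proper assignment set for a closed walk W in the brickwall 𝓑. Then every elementary cycle C of (W, A) is a right-turn walk. -/

import Mathlib

open scoped Classical

namespace Hex

/-- Adjacency in the brickwall `𝓑`: vertex `(i,j)` is `b_{i,j}`.
Horizontal edges `b_{i,j} b_{i+1,j}` for all `i,j`, and vertical edges
`b_{i,j} b_{i+1,j+1}` for odd `i`. -/
def bwAdj (u v : ℤ × ℤ) : Prop :=
  (u.2 = v.2 ∧ (v.1 = u.1 + 1 ∨ u.1 = v.1 + 1)) ∨
  (Odd u.1 ∧ v.1 = u.1 + 1 ∧ v.2 = u.2 + 1) ∨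
  (Odd v.1 ∧ u.1 = v.1 + 1 ∧ u.2 = v.2 + 1)

/-- A closed walk of length `k` in the brickwall, represented by a `k`-periodic
function `f : ℤ → ℤ × ℤ` (so `W_i = f i`), with adjacency and no turning back. -/
def IsClosedWalk (k : ℕ) (f : ℤ → ℤ × ℤ) : Prop :=
  0 < k ∧ (∀ i : ℤ, f (i + (k : ℤ)) = f i) ∧ (∀ i : ℤ, bwAdj (f i) (f (i + 1))) ∧
    (∀ i : ℤ, f (i - 1) ≠ f (i + 1))

/-- The neighbor of `v` immediately following `u` in the clockwise order
around `v` in the planar drawing of the brickwall: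
around `b_{i,j}` with `i` odd the clockwise order is
`(b_{i+1,j+1}, b_{i+1,j}, b_{i-1,j})`, and with `i` even it is
`(b_{i+1,j}, b_{i-1,j-1}, b_{i-1,j})`. -/
def cwNext (v u : ℤ × ℤ) : ℤ × ℤ :=
  if v.1 % 2 = 0 then
    (if u = (v.1 + 1, v.2) then (v.1 - 1, v.2 - 1)
     else if u = (v.1 - 1, v.2 - 1) then (v.1 - 1, v.2)
     else (v.1 + 1, v.2))
  else
    (if u = (v.1 + 1, v.2 + 1) then (v.1 + 1, v.2)
     else if u = (v.1 + 1, v.2) then (v.1 - 1, v.2)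
     else (v.1 + 1, v.2 + 1))

/-- `W` makes a right turn at `i`: `W_{i-1}` immediately follows `W_{i+1}` clockwise. -/
def RightTurn (f : ℤ → ℤ × ℤ) (i : ℤ) : Prop := f (i - 1) = cwNext (f i) (f (i + 1))

/-- `W` makes a left turn at `i`: `W_{i+1}` immediately follows `W_{i-1}` clockwise. -/
def LeftTurn (f : ℤ → ℤ × ℤ) (i : ℤ) : Prop := f (i + 1) = cwNext (f i) (f (i - 1))

noncomputable def rightCount (k : ℕ) (f : ℤ → ℤ × ℤ) : ℕ :=
  ((Finset.range k).filter fun t => RightTurn f (t : ℤ)).card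

noncomputable def leftCount (k : ℕ) (f : ℤ → ℤ × ℤ) : ℕ :=
  ((Finset.range k).filter fun t => LeftTurn f (t : ℤ)).card

/-- The turning number `t(W) = (Right(W) - Left(W))/6`. -/
noncomputable def turningNumber (k : ℕ) (f : ℤ → ℤ × ℤ) : ℚ :=
  ((rightCount k f : ℚ) - (leftCount k f : ℚ)) / 6

/-- `uv` is a horizontal right edge: same height, smaller first coordinate even. -/
def HorizRight (u v : ℤ × ℤ) : Prop := u.2 = v.2 ∧ Even (min u.1 v.1)

/-- `uv` is a horizontal left edge: same height, smaller first coordinate odd. -/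
def HorizLeft (u v : ℤ × ℤ) : Prop := u.2 = v.2 ∧ Odd (min u.1 v.1)

/-- A right-turn walk: every vertical edge is immediately followed by a horizontal
right edge and immediately preceded by a horizontal left edge. -/
def IsRightTurnWalk (f : ℤ → ℤ × ℤ) : Prop :=
  ∀ i : ℤ, (f i).2 ≠ (f (i + 1)).2 →
    HorizRight (f (i + 1)) (f (i + 2)) ∧ HorizLeft (f (i - 1)) (f i)

/-- The unique neighbor of `W_i` other than `W_{i-1}` and `W_{i+1}`. -/
def thirdNb (f : ℤ → ℤ × ℤ) (i : ℤ) : ℤ × ℤ :=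
  if cwNext (f i) (f (i + 1)) = f (i - 1) then cwNext (f i) (f (i - 1))
  else cwNext (f i) (f (i + 1))

/-- `i ∈ {0,…,k-1}` is a PA-index: `W` makes a left turn at `i` and the third
neighbor of `W_i` has the same height as `W_i`. -/
def IsPAIndex (k : ℕ) (f : ℤ → ℤ × ℤ) (i : ℤ) : Prop :=
  0 ≤ i ∧ i < (k : ℤ) ∧ LeftTurn f i ∧ (thirdNb f i).2 = (f i).2

/-- The horizontal path in the brickwall from `u` to `v` (same height), as a list. -/
def horizPath (u v : ℤ × ℤ) : List (ℤ × ℤ) :=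
  if u.1 ≤ v.1 then (List.range ((v.1 - u.1).toNat + 1)).map fun t => (u.1 + (t : ℤ), u.2)
  else (List.range ((u.1 - v.1).toNat + 1)).map fun t => (u.1 - (t : ℤ), u.2)

/-- `p = {x,y}` is a possible assignment (PA) of the closed walk. -/
def IsPA (k : ℕ) (f : ℤ → ℤ × ℤ) (p : Finset ℤ) : Prop :=
  ∃ x y : ℤ, p = {x, y} ∧ IsPAIndex k f x ∧ IsPAIndex k f y ∧
    f x ≠ f y ∧ (f x).2 = (f y).2 ∧
    ∀ z ∈ horizPath (f x) (f y),
      z ≠ f (x - 1) ∧ z ≠ f (x + 1) ∧ z ≠ f (y - 1) ∧ z ≠ f (y + 1)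

/-- A proper assignment set: a set of PAs forming a non-crossing perfect matching
on the PA-indices. -/
def IsProperAssignment (k : ℕ) (f : ℤ → ℤ × ℤ) (A : Set (Finset ℤ)) : Prop :=
  (∀ p ∈ A, IsPA k f p) ∧
  (∀ i : ℤ, IsPAIndex k f i → ∃! p, p ∈ A ∧ i ∈ p) ∧
  (∀ p ∈ A, ∀ q ∈ A, ∀ i ∈ p, ∀ j ∈ p, ∀ x ∈ q, ∀ y ∈ q, ¬(i < x ∧ x < j ∧ j < y))

/-- `n(i)`: the first PA-index strictly after `i` in cyclic order
(minimizing the cyclic distance `((j - i - 1) mod k) + 1`). -/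
noncomputable def nextPA (k : ℕ) (f : ℤ → ℤ × ℤ) (i : ℤ) : ℤ :=
  if h : ∃ j : ℤ, IsPAIndex k f j ∧ ∀ j' : ℤ, IsPAIndex k f j' →
      (j - i - 1) % (k : ℤ) ≤ (j' - i - 1) % (k : ℤ)
  then h.choose else 0

/-- The subwalk `W_{x,y}` of the closed walk, as a list of `((y-x) mod k) + 1` vertices. -/
def subwalkList (k : ℕ) (f : ℤ → ℤ × ℤ) (x y : ℤ) : List (ℤ × ℤ) :=
  (List.range (((y - x) % (k : ℤ)).toNat + 1)).map fun t => f (x + (t : ℤ))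

/-- The cyclic function `ℤ → ℤ × ℤ` determined by a list of vertices. -/
def listFun (L : List (ℤ × ℤ)) : ℤ → ℤ × ℤ :=
  fun z => L.getD ((z % (L.length : ℤ)).toNat) (0, 0)

/-- An elementary cycle of `(W, A)`, given by its index sequence
`i_0, …, i_l` of PA-indices with `{n(i_t), i_{t+1}} ∈ A`, `{n(i_l), i_0} ∈ A`,
and canonical rotation `i_0 < i_t` for `t ≥ 1`. -/
structure ElemCycle (k : ℕ) (f : ℤ → ℤ × ℤ) (A : Set (Finset ℤ)) where
  l : ℕ
  idx : ℕ → ℤ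
  pa : ∀ t : ℕ, t ≤ l → IsPAIndex k f (idx t)
  mem : ∀ t : ℕ, t < l → ({nextPA k f (idx t), idx (t + 1)} : Finset ℤ) ∈ A
  memLast : ({nextPA k f (idx l), idx 0} : Finset ℤ) ∈ A
  minimal : ∀ t : ℕ, 1 ≤ t → t ≤ l → idx 0 < idx t
  canon : ∀ t : ℕ, l < t → idx t = idx 0

/-- The `t`-th segment `W_{i_t, n(i_t)} ∘ H_{n(i_t), i_{t+1}}` of an elementary
cycle (with final vertex dropped, for concatenation). -/
noncomputable def ecSegment {k : ℕ} {f : ℤ → ℤ × ℤ} {A : Set (Finset ℤ)}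
    (E : ElemCycle k f A) (t : ℕ) : List (ℤ × ℤ) :=
  (subwalkList k f (E.idx t) (nextPA k f (E.idx t))).dropLast ++
  (horizPath (f (nextPA k f (E.idx t))) (f (E.idx (if t = E.l then 0 else t + 1)))).dropLast

/-- The closed walk `C = W_{i_0,n(i_0)} ∘ H_{n(i_0),i_1} ∘ ⋯ ∘ H_{n(i_l),i_0}` of an
elementary cycle, as a list (without the repeated final vertex). -/
noncomputable def ecOpenList {k : ℕ} {f : ℤ → ℤ × ℤ} {A : Set (Finset ℤ)}
    (E : ElemCycle k f A) : List (ℤ × ℤ) :=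
  (List.range (E.l + 1)).flatMap (ecSegment E)

/-- The length of the closed walk of an elementary cycle. -/
noncomputable def ecLen {k : ℕ} {f : ℤ → ℤ × ℤ} {A : Set (Finset ℤ)}
    (E : ElemCycle k f A) : ℕ := (ecOpenList E).length

/-- The closed walk of an elementary cycle, as a periodic function. -/
noncomputable def ecFun {k : ℕ} {f : ℤ → ℤ × ℤ} {A : Set (Finset ℤ)}
    (E : ElemCycle k f A) : ℤ → ℤ × ℤ := listFun (ecOpenList E)

/-- `(m, g)` is (the closed walk of) an elementary cycle of `(W, A)`; if `A = ∅`
and `W` has no PA-index, `W` itself is the unique elementary cycle. -/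
def IsElemCycleWalk (k : ℕ) (f : ℤ → ℤ × ℤ) (A : Set (Finset ℤ))
    (m : ℕ) (g : ℤ → ℤ × ℤ) : Prop :=
  (∃ E : ElemCycle k f A, m = ecLen E ∧ g = ecFun E) ∨
  (A = ∅ ∧ (∀ i : ℤ, ¬ IsPAIndex k f i) ∧ m = k ∧ g = f)

/-- The number of elementary cycles of `(W, A)` (elementary cycles being
identified with their index sequences). -/
noncomputable def numElemCycles (k : ℕ) (f : ℤ → ℤ × ℤ) (A : Set (Finset ℤ)) : ℕ :=
  if A = ∅ ∧ ∀ i : ℤ, ¬ IsPAIndex k f i then 1 else Nat.card (ElemCycle k f A)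

/-- The number of PA-indices of the closed walk. -/
noncomputable def paCount (k : ℕ) (f : ℤ → ℤ × ℤ) : ℕ :=
  Nat.card {i : ℤ // IsPAIndex k f i}

/-- The walk `W' = W_{0,y} ∘ H_{y,0}`, as a list (without repeated final vertex). -/
noncomputable def splitList (k : ℕ) (f : ℤ → ℤ × ℤ) (y : ℤ) : List (ℤ × ℤ) :=
  (subwalkList k f 0 y).dropLast ++ (horizPath (f y) (f 0)).dropLast

/-- The length of the walk `W' = W_{0,y} ∘ H_{y,0}`. -/
noncomputable def splitLen (k : ℕ) (f : ℤ → ℤ × ℤ) (y : ℤ) : ℕ := (splitList k f y).length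

/-- The walk `W' = W_{0,y} ∘ H_{y,0}`, as a periodic function. -/
noncomputable def splitFun (k : ℕ) (f : ℤ → ℤ × ℤ) (y : ℤ) : ℤ → ℤ × ℤ :=
  listFun (splitList k f y)

/-- `Σ_{C ∈ 𝒞} (t(C) - 1)` over the set `𝒞` of elementary cycles of `(W, A)`. -/
noncomputable def elemTurnSum (k : ℕ) (f : ℤ → ℤ × ℤ) (A : Set (Finset ℤ)) : ℚ :=
  if A = ∅ ∧ ∀ i : ℤ, ¬ IsPAIndex k f i then turningNumber k f - 1
  else ∑ᶠ E : ElemCycle k f A, (turningNumber (ecLen E) (ecFun E) - 1)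

/-- The condition a right-turn walk imposes on three consecutive vertices `a, b, c`. -/
def RightTurnTriple (a b c : ℤ × ℤ) : Prop :=
  (a.2 ≠ b.2 → HorizRight b c) ∧ (b.2 ≠ c.2 → HorizLeft a b)

/-- The edge `e'` may follow the edge `e` in a right-turn walk. -/
def EdgeFollows (e e' : (ℤ × ℤ) × (ℤ × ℤ)) : Prop :=
  e.2 = e'.1 ∧ RightTurnTriple e.1 e.2 e'.2

lemma isRightTurnWalk_of_triples {g : ℤ → ℤ × ℤ}
    (h : ∀ i, RightTurnTriple (g (i - 1)) (g i) (g (i + 1))) : IsRightTurnWalk g := by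
  intro i hi
  have h₁ := (h (i + 1)).1
  rw [add_sub_cancel_right, show i + 1 + 1 = i + 2 by ring] at h₁
  exact ⟨h₁ hi, (h i).2 hi⟩

lemma RightTurnTriple.of_horizontal {a b c : ℤ × ℤ} (hab : a.2 = b.2) (hbc : b.2 = c.2) :
    RightTurnTriple a b c :=
  ⟨fun h => absurd hab h, fun h => absurd hbc h⟩

lemma bwAdj.symm {u v : ℤ × ℤ} (h : bwAdj u v) : bwAdj v u := by
  unfold bwAdj at *
  tauto

lemma bwAdj.eq_neighbor {u v : ℤ × ℤ} (h : bwAdj u v) :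
    v = (u.1 + 1, u.2) ∨ v = (u.1 - 1, u.2) ∨ (u.1 % 2 = 1 ∧ v = (u.1 + 1, u.2 + 1)) ∨
      (u.1 % 2 = 0 ∧ v = (u.1 - 1, u.2 - 1)) := by
  simp only [bwAdj, Int.odd_iff, Prod.ext_iff] at *
  omega

lemma rightTurnTriple_of_not_PA {a b c : ℤ × ℤ} (hab : bwAdj a b) (hbc : bwAdj b c) (hac : a ≠ c)
    (h : ¬(c = cwNext b a ∧
      (if cwNext b c = a then cwNext b a else cwNext b c).2 = b.2)) :
    RightTurnTriple a b c := by
  obtain ⟨b₁, b₂⟩ := b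
  have hp := Int.emod_two_eq_zero_or_one b₁
  rcases hab.symm.eq_neighbor with rfl | rfl | ⟨hb, rfl⟩ | ⟨hb, rfl⟩ <;>
  rcases hbc.eq_neighbor with rfl | rfl | ⟨hb', rfl⟩ | ⟨hb', rfl⟩ <;>
  clear hab hbc <;>
  simp [RightTurnTriple, HorizRight, HorizLeft, cwNext, Int.even_iff, Int.odd_iff,
    Prod.ext_iff] at hac h hp ⊢ <;>
  grind

lemma rightTurnTriple_of_leftTurn {a b c w : ℤ × ℤ} (hab : bwAdj a b) (hbc : bwAdj b c)
    (hac : a ≠ c) (h : c = cwNext b a) (hw₂ : w.2 = b.2) (hw₁ : w.1 = b.1 + 1 ∨ w.1 = b.1 - 1)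
    (hwa : w ≠ a) (hwc : w ≠ c) :
    RightTurnTriple a b w ∧ RightTurnTriple w b c := by
  obtain ⟨b₁, b₂⟩ := b
  obtain ⟨w₁, w₂⟩ := w
  have hp := Int.emod_two_eq_zero_or_one b₁
  rcases hab.symm.eq_neighbor with rfl | rfl | ⟨hb, rfl⟩ | ⟨hb, rfl⟩ <;>
  rcases hbc.eq_neighbor with rfl | rfl | ⟨hb', rfl⟩ | ⟨hb', rfl⟩ <;>
  clear hab hbc <;>
  simp [RightTurnTriple, HorizRight, HorizLeft, cwNext, Int.even_iff, Int.odd_iff,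
    Prod.ext_iff] at hac h hp hw₁ hw₂ hwa hwc ⊢ <;>
  grind

section ClosedWalk

variable {k : ℕ} {f : ℤ → ℤ × ℤ}

lemma IsClosedWalk.apply_eq_of_modEq (hW : IsClosedWalk k f) {x y : ℤ}
    (h : x % (k : ℤ) = y % (k : ℤ)) : f x = f y := by
  have hp : Function.Periodic f (k : ℤ) := hW.2.1
  have key : ∀ z, f (z % (k : ℤ)) = f z := fun z => by
    have := hp.int_mul (z / (k : ℤ)) (z % (k : ℤ))
    rw [← this, Int.cast_id, mul_comm, Int.emod_add_mul_ediv]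
  rw [← key x, ← key y, h]

lemma IsClosedWalk.bwAdj_prev (hW : IsClosedWalk k f) (i : ℤ) : bwAdj (f (i - 1)) (f i) := by
  simpa using hW.2.2.1 (i - 1)

lemma IsClosedWalk.rightTurnTriple_of_not_isPAIndex (hW : IsClosedWalk k f) {i : ℤ}
    (h : ¬IsPAIndex k f (i % (k : ℤ))) : RightTurnTriple (f (i - 1)) (f i) (f (i + 1)) := by
  refine rightTurnTriple_of_not_PA (hW.bwAdj_prev i) (hW.2.2.1 i) (hW.2.2.2 i) fun hPA => h ?_
  have hk : (0 : ℤ) < k := by exact_mod_cast hW.1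
  have e₀ : f (i % (k : ℤ)) = f i := hW.apply_eq_of_modEq (by simp)
  have e₁ : f (i % (k : ℤ) - 1) = f (i - 1) := hW.apply_eq_of_modEq (by simp)
  have e₂ : f (i % (k : ℤ) + 1) = f (i + 1) := hW.apply_eq_of_modEq (by simp)
  refine ⟨Int.emod_nonneg _ hk.ne', Int.emod_lt_of_pos _ hk, ?_, ?_⟩
  · rw [LeftTurn, e₀, e₁, e₂]
    exact hPA.1
  · rw [thirdNb, e₀, e₁, e₂]
    exact hPA.2

lemma IsClosedWalk.rightTurnTriple_of_isPAIndex (hW : IsClosedWalk k f) {x : ℤ}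
    (hx : IsPAIndex k f x) {w : ℤ × ℤ} (hw₂ : w.2 = (f x).2)
    (hw₁ : w.1 = (f x).1 + 1 ∨ w.1 = (f x).1 - 1) (hwp : w ≠ f (x - 1)) (hws : w ≠ f (x + 1)) :
    RightTurnTriple (f (x - 1)) (f x) w ∧ RightTurnTriple w (f x) (f (x + 1)) :=
  rightTurnTriple_of_leftTurn (hW.bwAdj_prev x) (hW.2.2.1 x) (hW.2.2.2 x) hx.2.2.1 hw₂ hw₁ hwp hws

lemma nextPA_spec (i : ℤ) (h : ∃ j, IsPAIndex k f j) :
    IsPAIndex k f (nextPA k f i) ∧ ∀ j, IsPAIndex k f j →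
      (nextPA k f i - i - 1) % (k : ℤ) ≤ (j - i - 1) % (k : ℤ) := by
  have hex : ∃ j : ℤ, IsPAIndex k f j ∧ ∀ j' : ℤ, IsPAIndex k f j' →
      (j - i - 1) % (k : ℤ) ≤ (j' - i - 1) % (k : ℤ) := by
    have hfin : {j | IsPAIndex k f j}.Finite :=
      (Set.finite_Ico (0 : ℤ) k).subset fun j hj => ⟨hj.1, hj.2.1⟩
    exact Set.exists_min_image _ (fun j : ℤ => (j - i - 1) % (k : ℤ)) hfin h
  rw [nextPA, dif_pos hex]
  exact hex.choose_spec

/-- `n(x) ≠ x` as soon as there is a second PA-index. -/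
lemma nextPA_ne {x y : ℤ} (hx : IsPAIndex k f x) (hy : IsPAIndex k f y) (hxy : x ≠ y) :
    nextPA k f x ≠ x := by
  intro h
  have h₁ := (nextPA_spec x ⟨x, hx⟩).2 y hy
  obtain ⟨hx₀, hxk, -⟩ := hx
  obtain ⟨hy₀, hyk, -⟩ := hy
  rw [h, sub_self, zero_sub, ← Int.add_emod_right,
    Int.emod_eq_of_lt (by omega) (by omega)] at h₁
  rcases lt_or_gt_of_ne hxy with hlt | hlt
  · rw [Int.emod_eq_of_lt (by omega) (by omega)] at h₁
    omega
  · rw [← Int.add_emod_right, Int.emod_eq_of_lt (by omega) (by omega)] at h₁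
    omega

/-- No PA-index lies strictly between `x` and `n(x)`. -/
lemma not_isPAIndex_of_lt_nextPA {x t : ℤ} (ht₀ : 0 < t) (ht : t < (nextPA k f x - x) % (k : ℤ)) :
    ¬IsPAIndex k f ((x + t) % (k : ℤ)) := by
  intro hPA
  have hle := (nextPA_spec x ⟨_, hPA⟩).2 _ hPA
  have hk : (0 : ℤ) < k := hPA.1.trans_lt hPA.2.1
  have hlt := Int.emod_lt_of_pos (nextPA k f x - x) hk
  have e₁ : ((x + t) % (k : ℤ) - x - 1) % (k : ℤ) = t - 1 := by
    rw [sub_sub, Int.emod_sub_emod, show x + t - (x + 1) = t - 1 by ring,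
      Int.emod_eq_of_lt (by omega) (by omega)]
  have e₂ : (nextPA k f x - x - 1) % (k : ℤ) = (nextPA k f x - x) % (k : ℤ) - 1 := by
    rw [← Int.emod_sub_emod, Int.emod_eq_of_lt (by omega) (by omega)]
  omega

end ClosedWalk

section Edges

/-- The list of edges of the subwalk `W_{x,y}`. -/
def subwalkEdges (k : ℕ) (f : ℤ → ℤ × ℤ) (x y : ℤ) : List ((ℤ × ℤ) × (ℤ × ℤ)) :=
  (List.range ((y - x) % (k : ℤ)).toNat).map fun t : ℕ => (f (x + (t : ℤ)), f (x + (t : ℤ) + 1))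

/-- The vertex at distance `t` from `u` on the horizontal ray from `u` towards `v`. -/
def horizPoint (u v : ℤ × ℤ) (t : ℤ) : ℤ × ℤ := (u.1 + (v.1 - u.1).sign * t, u.2)

/-- The list of edges of the horizontal path from `u` to `v`. -/
def horizEdges (u v : ℤ × ℤ) : List ((ℤ × ℤ) × (ℤ × ℤ)) :=
  (List.range (v.1 - u.1).natAbs).map fun t : ℕ =>
    (horizPoint u v (t : ℤ), horizPoint u v ((t : ℤ) + 1))

lemma map_natCast_range {α : Type*} (n : ℕ) (h : ℤ → α) :
    List.map h (do let a ← List.range n; pure (a : ℤ)) =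
      (List.range n).map fun t : ℕ => h (t : ℤ) := by
  simp [List.bind_eq_flatMap, ← List.map_eq_flatMap]

lemma map_fst_subwalkEdges (k : ℕ) (f : ℤ → ℤ × ℤ) (x y : ℤ) :
    (subwalkEdges k f x y).map Prod.fst = (subwalkList k f x y).dropLast := by
  rw [subwalkList, map_natCast_range]
  simp [subwalkEdges, List.range_succ, Function.comp_def]

lemma horizPath_eq_map (u v : ℤ × ℤ) :
    horizPath u v = (List.range ((v.1 - u.1).natAbs + 1)).map fun t : ℕ => horizPoint u v (t : ℤ) := by
  unfold horizPath horizPoint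
  simp only [map_natCast_range]
  rcases lt_trichotomy u.1 v.1 with h | h | h
  · rw [if_pos h.le, Int.sign_eq_one_of_pos (by omega),
      show (v.1 - u.1).toNat = (v.1 - u.1).natAbs by omega]
    simp
  · simp [h]
  · rw [if_neg h.not_ge, Int.sign_eq_neg_one_of_neg (by omega),
      show (u.1 - v.1).toNat = (v.1 - u.1).natAbs by omega]
    simp [sub_eq_add_neg]

lemma map_fst_horizEdges (u v : ℤ × ℤ) :
    (horizEdges u v).map Prod.fst = (horizPath u v).dropLast := by
  rw [horizPath_eq_map]
  simp [horizEdges, List.range_succ, Function.comp_def]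

lemma mem_horizPath_iff {u v z : ℤ × ℤ} :
    z ∈ horizPath u v ↔ z.2 = u.2 ∧ min u.1 v.1 ≤ z.1 ∧ z.1 ≤ max u.1 v.1 := by
  obtain ⟨z₁, z₂⟩ := z
  unfold horizPath
  split_ifs with h <;> simp only [map_natCast_range, List.mem_map, List.mem_range, Prod.mk.injEq]
  · constructor
    · rintro ⟨t, ht, rfl, rfl⟩
      omega
    · rintro ⟨h₂, h₁, h₃⟩
      exact ⟨(z₁ - u.1).toNat, by omega, by omega, h₂.symm⟩
  · constructor
    · rintro ⟨t, ht, rfl, rfl⟩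
      omega
    · rintro ⟨h₂, h₁, h₃⟩
      exact ⟨(u.1 - z₁).toNat, by omega, by omega, h₂.symm⟩

lemma head?_map_range {α : Type*} (n : ℕ) (h : ℕ → α) (hn : 0 < n) :
    ((List.range n).map h).head? = some (h 0) := by
  obtain ⟨m, rfl⟩ := Nat.exists_eq_add_of_lt hn
  simp [List.range_succ_eq_map]

lemma getLast?_map_range {α : Type*} (n : ℕ) (h : ℕ → α) (hn : 0 < n) :
    ((List.range n).map h).getLast? = some (h (n - 1)) := by
  obtain ⟨m, rfl⟩ := Nat.exists_eq_add_of_lt hn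
  simp [List.range_succ]

lemma head?_horizEdges {u v : ℤ × ℤ} (huv : u.1 ≠ v.1) :
    (horizEdges u v).head? = some (u, horizPoint u v 1) := by
  rw [horizEdges, head?_map_range _ _ (by omega)]
  simp [horizPoint]

lemma getLast?_horizEdges {u v : ℤ × ℤ} (huv : u.1 ≠ v.1) (h₂ : u.2 = v.2) :
    (horizEdges u v).getLast? = some (horizPoint v u 1, v) := by
  rw [horizEdges, getLast?_map_range _ _ (by omega)]
  obtain ⟨u₁, u₂⟩ := u
  obtain ⟨v₁, v₂⟩ := v
  simp only [horizPoint, Option.some.injEq, Prod.mk.injEq] at *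
  rcases lt_or_gt_of_ne huv with h | h
  · rw [Int.sign_eq_one_of_pos (by omega), Int.sign_eq_neg_one_of_neg (by omega)]
    omega
  · rw [Int.sign_eq_neg_one_of_neg (by omega), Int.sign_eq_one_of_pos (by omega)]
    omega

lemma horizPoint_one_mem {u v : ℤ × ℤ} (huv : u.1 ≠ v.1) :
    horizPoint u v 1 ∈ horizPath u v := by
  rw [horizPath_eq_map]
  exact List.mem_map.2 ⟨1, List.mem_range.2 (by omega), by simp⟩

lemma horizPoint_one_fst {u v : ℤ × ℤ} (huv : u.1 ≠ v.1) :
    (horizPoint u v 1).1 = u.1 + 1 ∨ (horizPoint u v 1).1 = u.1 - 1 := by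
  rcases lt_or_gt_of_ne huv with h | h
  · exact .inl (by simp [horizPoint, Int.sign_eq_one_of_pos (sub_pos.2 h)])
  · exact .inr (by simp [horizPoint, Int.sign_eq_neg_one_of_neg (sub_neg.2 h), ← sub_eq_add_neg])

lemma isChain_horizEdges (u v : ℤ × ℤ) : (horizEdges u v).IsChain EdgeFollows := by
  rw [horizEdges, List.isChain_map, List.isChain_range]
  intro t _
  exact ⟨by simp, .of_horizontal rfl rfl⟩

variable {k : ℕ} {f : ℤ → ℤ × ℤ}

lemma isChain_subwalkEdges_nextPA (hW : IsClosedWalk k f) (x : ℤ) :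
    (subwalkEdges k f x (nextPA k f x)).IsChain EdgeFollows := by
  rw [subwalkEdges, List.isChain_map, List.isChain_range]
  intro t ht
  refine ⟨by simp [add_assoc], ?_⟩
  have h := hW.rightTurnTriple_of_not_isPAIndex
    (not_isPAIndex_of_lt_nextPA (f := f) (x := x) (t := t + 1) (by omega) (by omega))
  convert h using 2 <;> push_cast <;> ring_nf

lemma toNat_emod_sub_pos {x y : ℤ} (hx : IsPAIndex k f x) (hy : IsPAIndex k f y) (hxy : x ≠ y) :
    0 < ((y - x) % (k : ℤ)).toNat := by
  obtain ⟨hx₀, hxk, -⟩ := hx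
  obtain ⟨hy₀, hyk, -⟩ := hy
  have h₀ := Int.emod_nonneg (y - x) (b := (k : ℤ)) (by omega)
  by_contra h
  obtain ⟨c, hc⟩ := Int.dvd_of_emod_eq_zero (show (y - x) % (k : ℤ) = 0 by omega)
  have := Int.eq_zero_of_abs_lt_dvd (m := (k : ℤ)) ⟨c, hc⟩ (abs_lt.2 ⟨by omega, by omega⟩)
  omega

lemma head?_subwalkEdges {x y : ℤ} (hx : IsPAIndex k f x) (hy : IsPAIndex k f y) (hxy : x ≠ y) :
    (subwalkEdges k f x y).head? = some (f x, f (x + 1)) := by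
  rw [subwalkEdges, head?_map_range _ _ (toNat_emod_sub_pos hx hy hxy)]
  simp

lemma getLast?_subwalkEdges (hW : IsClosedWalk k f) {x y : ℤ} (hx : IsPAIndex k f x)
    (hy : IsPAIndex k f y) (hxy : x ≠ y) :
    (subwalkEdges k f x y).getLast? = some (f (y - 1), f y) := by
  have hpos := toNat_emod_sub_pos hx hy hxy
  rw [subwalkEdges, getLast?_map_range _ _ hpos]
  have hcast : ((((y - x) % (k : ℤ)).toNat - 1 : ℕ) : ℤ) = (y - x) % (k : ℤ) - 1 := by omega
  rw [hcast]
  congr 2 <;> apply hW.apply_eq_of_modEq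
  · rw [← add_sub_assoc, Int.sub_emod, Int.add_emod_emod, add_sub_cancel, ← Int.sub_emod]
  · rw [add_assoc, sub_add_cancel, Int.add_emod_emod, add_sub_cancel]

end Edges

section Assignment

variable {k : ℕ} {f : ℤ → ℤ × ℤ} {A : Set (Finset ℤ)}

/-- A possible assignment `{x, y}` in terms of its given enumeration. -/
lemma IsPA.pair {x y : ℤ} (h : IsPA k f {x, y}) :
    IsPAIndex k f x ∧ IsPAIndex k f y ∧ (f x).1 ≠ (f y).1 ∧ (f x).2 = (f y).2 ∧
      ∀ z ∈ horizPath (f x) (f y),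
        z ≠ f (x - 1) ∧ z ≠ f (x + 1) ∧ z ≠ f (y - 1) ∧ z ≠ f (y + 1) := by
  obtain ⟨a, b, hab, ha, hb, hne, h₂, hz⟩ := h
  have hne₁ : (f a).1 ≠ (f b).1 := fun h₁ => hne (Prod.ext h₁ h₂)
  have hset : ({x, y} : Set ℤ) = {a, b} := by
    have := congrArg (fun s : Finset ℤ => (s : Set ℤ)) hab
    simpa using this
  rcases Set.pair_eq_pair_iff.1 hset with ⟨rfl, rfl⟩ | ⟨rfl, rfl⟩
  · exact ⟨ha, hb, hne₁, h₂, hz⟩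
  · refine ⟨hb, ha, hne₁.symm, h₂.symm, fun z hmem => ?_⟩
    rw [mem_horizPath_iff, min_comm, max_comm, ← h₂, ← mem_horizPath_iff] at hmem
    obtain ⟨h₁, h₂, h₃, h₄⟩ := hz z hmem
    exact ⟨h₃, h₄, h₁, h₂⟩

/-- A possible assignment lets the walk arriving at `x` continue along `H_{x,y}`,
and `H_{x,y}` continue along the walk leaving `y`. -/
lemma IsPA.edgeFollows (hW : IsClosedWalk k f) {x y : ℤ} (h : IsPA k f {x, y}) :
    EdgeFollows (f (x - 1), f x) (f x, horizPoint (f x) (f y) 1) ∧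
      EdgeFollows (horizPoint (f y) (f x) 1, f y) (f y, f (y + 1)) := by
  obtain ⟨-, -, -, -, hzy⟩ := IsPA.pair (show IsPA k f {y, x} from Finset.pair_comm x y ▸ h)
  obtain ⟨hx, hy, hne, h₂, hz⟩ := h.pair
  obtain ⟨hp, hs, -⟩ := hz _ (horizPoint_one_mem hne)
  obtain ⟨hyp, hys, -⟩ := hzy _ (horizPoint_one_mem hne.symm)
  exact ⟨⟨rfl, (hW.rightTurnTriple_of_isPAIndex hx (w := horizPoint _ _ 1) rfl
      (horizPoint_one_fst hne) hp hs).1⟩,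
    ⟨rfl, (hW.rightTurnTriple_of_isPAIndex hy (w := horizPoint _ _ 1) rfl
      (horizPoint_one_fst hne.symm) hyp hys).2⟩⟩

/-- The edges of the segment `W_{x,n(x)} ∘ H_{n(x),y}`. -/
noncomputable def segmentEdges (k : ℕ) (f : ℤ → ℤ × ℤ) (x y : ℤ) : List ((ℤ × ℤ) × (ℤ × ℤ)) :=
  subwalkEdges k f x (nextPA k f x) ++ horizEdges (f (nextPA k f x)) (f y)

lemma ne_nextPA_of_isPA {x y : ℤ} (hx : IsPAIndex k f x) (h : IsPA k f {nextPA k f x, y}) :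
    x ≠ nextPA k f x := by
  obtain ⟨hn, hy, hne, -⟩ := h.pair
  by_cases hxy : x = y
  · intro hxn
    exact hne (by rw [← hxn, ← hxy])
  · exact (nextPA_ne hx hy hxy).symm

lemma head?_segmentEdges {x y : ℤ} (hx : IsPAIndex k f x) (h : IsPA k f {nextPA k f x, y}) :
    (segmentEdges k f x y).head? = some (f x, f (x + 1)) := by
  simp [segmentEdges, List.head?_append,
    head?_subwalkEdges hx h.pair.1 (ne_nextPA_of_isPA hx h)]

lemma getLast?_segmentEdges {x y : ℤ} (h : IsPA k f {nextPA k f x, y}) :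
    (segmentEdges k f x y).getLast? = some (horizPoint (f y) (f (nextPA k f x)) 1, f y) := by
  obtain ⟨-, -, hne, h₂, -⟩ := h.pair
  simp [segmentEdges, List.getLast?_append, getLast?_horizEdges hne h₂]

lemma isChain_segmentEdges (hW : IsClosedWalk k f) {x y : ℤ} (hx : IsPAIndex k f x)
    (h : IsPA k f {nextPA k f x, y}) : (segmentEdges k f x y).IsChain EdgeFollows := by
  obtain ⟨hn, -, hne, -⟩ := h.pair
  refine (isChain_subwalkEdges_nextPA hW x).append (isChain_horizEdges _ _) ?_
  rw [getLast?_subwalkEdges hW hx hn (ne_nextPA_of_isPA hx h), head?_horizEdges hne]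
  rintro _ ⟨⟩ _ ⟨⟩
  exact (h.edgeFollows hW).1

/-- A closed list of edges in which consecutive edges follow each other traces
a right-turn walk. -/
lemma isRightTurnWalk_listFun {L : List ((ℤ × ℤ) × (ℤ × ℤ))} (hL : L ≠ [])
    (hchain : L.IsChain EdgeFollows)
    (hclose : ∀ e ∈ L.getLast?, ∀ e' ∈ L.head?, EdgeFollows e e') :
    IsRightTurnWalk (listFun (L.map Prod.fst)) := by
  have hpos : 0 < L.length := List.length_pos_of_ne_nil hL
  have hpos' : (0 : ℤ) < L.length := by exact_mod_cast hpos
  set F : ℤ → (ℤ × ℤ) × (ℤ × ℤ) := fun z => L.getD (z % (L.length : ℤ)).toNat ((0, 0), (0, 0))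
    with hF
  have hfst : ∀ z, listFun (L.map Prod.fst) z = (F z).1 := by
    intro z
    have h := Int.emod_lt_of_pos z hpos'
    have h₀ := Int.emod_nonneg z hpos'.ne'
    simp only [listFun, hF, List.length_map]
    rw [List.getD_eq_getElem _ _ (by rw [List.length_map]; omega),
      List.getD_eq_getElem _ _ (by omega), List.getElem_map]
  have hfollow : ∀ z, EdgeFollows (F z) (F (z + 1)) := by
    intro z
    have h := Int.emod_lt_of_pos z hpos'
    have h₀ := Int.emod_nonneg z hpos'.ne'
    simp only [hF]
    by_cases hz : z % (L.length : ℤ) + 1 < L.length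
    · have e : ((z + 1) % (L.length : ℤ)).toNat = (z % (L.length : ℤ)).toNat + 1 := by
        rw [← Int.emod_add_emod, Int.emod_eq_of_lt (by omega) hz]
        omega
      rw [e, List.getD_eq_getElem _ _ (by omega), List.getD_eq_getElem _ _ (by omega)]
      exact List.isChain_iff_getElem.1 hchain _ (by omega)
    · have e : ((z + 1) % (L.length : ℤ)).toNat = 0 := by
        rw [← Int.emod_add_emod, show z % (L.length : ℤ) + 1 = L.length by omega, Int.emod_self]
        rfl
      have e' : (z % (L.length : ℤ)).toNat = L.length - 1 := by omega
      rw [e, e', List.getD_eq_getElem _ _ (by omega), List.getD_eq_getElem _ _ (by omega)]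
      apply hclose
      · simp [List.getLast?_eq_getElem?]
      · simp [List.head?_eq_getElem?]
  refine isRightTurnWalk_of_triples fun i => ?_
  have h₁ := hfollow (i - 1)
  have h₂ := hfollow i
  rw [sub_add_cancel] at h₁
  rw [hfst, hfst, hfst, ← h₂.1, ← h₁.1]
  exact h₁.2

/-- The index following `idx t` cyclically in an elementary cycle. -/
def ElemCycle.nextIdx (E : ElemCycle k f A) (t : ℕ) : ℤ :=
  E.idx (if t = E.l then 0 else t + 1)

/-- The list of edges of an elementary cycle. -/
noncomputable def ElemCycle.edges (E : ElemCycle k f A) : List ((ℤ × ℤ) × (ℤ × ℤ)) :=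
  (List.range (E.l + 1)).flatMap fun t => segmentEdges k f (E.idx t) (E.nextIdx t)

lemma ElemCycle.map_fst_edges (E : ElemCycle k f A) : E.edges.map Prod.fst = ecOpenList E := by
  simp only [ElemCycle.edges, ecOpenList, List.map_flatMap, segmentEdges, List.map_append,
    map_fst_subwalkEdges, map_fst_horizEdges]
  rfl

lemma ElemCycle.isPA (E : ElemCycle k f A) (hA : IsProperAssignment k f A) {t : ℕ}
    (ht : t ≤ E.l) : IsPA k f {nextPA k f (E.idx t), E.nextIdx t} := by
  apply hA.1
  unfold ElemCycle.nextIdx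
  split_ifs with h
  · exact h ▸ E.memLast
  · exact E.mem t (by omega)

lemma ElemCycle.isRightTurnWalk (E : ElemCycle k f A) (hW : IsClosedWalk k f)
    (hA : IsProperAssignment k f A) : IsRightTurnWalk (ecFun E) := by
  have hhead : ∀ t ≤ E.l, (segmentEdges k f (E.idx t) (E.nextIdx t)).head? =
      some (f (E.idx t), f (E.idx t + 1)) :=
    fun t ht => head?_segmentEdges (E.pa t ht) (E.isPA hA ht)
  have hlast : ∀ t ≤ E.l, (segmentEdges k f (E.idx t) (E.nextIdx t)).getLast? =
      some (horizPoint (f (E.nextIdx t)) (f (nextPA k f (E.idx t))) 1, f (E.nextIdx t)) :=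
    fun t ht => getLast?_segmentEdges (E.isPA hA ht)
  have hnext : ∀ t < E.l, E.nextIdx t = E.idx (t + 1) := fun t ht => by
    rw [ElemCycle.nextIdx, if_neg ht.ne]
  have hheadE : E.edges.head? = some (f (E.idx 0), f (E.idx 0 + 1)) := by
    rw [ElemCycle.edges, List.range_succ_eq_map, List.flatMap_cons, List.head?_append,
      hhead 0 (Nat.zero_le _)]
    rfl
  have hlastE : E.edges.getLast? = some
      (horizPoint (f (E.idx 0)) (f (nextPA k f (E.idx E.l))) 1, f (E.idx 0)) := by
    have h0 : E.nextIdx E.l = E.idx 0 := by simp [ElemCycle.nextIdx]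
    rw [ElemCycle.edges, List.range_succ, List.flatMap_append, List.getLast?_append,
      List.flatMap_singleton, hlast _ le_rfl, h0]
    rfl
  rw [ecFun, ← E.map_fst_edges]
  refine isRightTurnWalk_listFun (fun h => by simp [h] at hheadE) ?_ ?_
  · rw [ElemCycle.edges, List.flatMap_def, List.isChain_flatten]
    · refine ⟨?_, ?_⟩
      · simp only [List.mem_map, List.mem_range]
        rintro _ ⟨t, ht, rfl⟩
        exact isChain_segmentEdges hW (E.pa t (by omega)) (E.isPA hA (by omega))
      · rw [List.isChain_map, List.isChain_range_succ]
        intro t ht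
        rw [hlast t ht.le, hhead (t + 1) ht, ← hnext t ht]
        rintro _ ⟨⟩ _ ⟨⟩
        exact ((E.isPA hA ht.le).edgeFollows hW).2
    · simp only [List.mem_map, List.mem_range, not_exists, not_and]
      intro t ht h
      have := hhead t (by omega)
      simp [h] at this
  · rw [hheadE, hlastE]
    rintro _ ⟨⟩ _ ⟨⟩
    exact ((hA.1 _ E.memLast).edgeFollows hW).2

end Assignment

/-- Let `A` be a proper assignment set for a closed walk `W` in the
brickwall. Then every elementary cycle `C` of `(W, A)` is a right-turn walk. -/
theorem elemCycle_isRightTurnWalk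
    (k : ℕ) (f : ℤ → ℤ × ℤ) (A : Set (Finset ℤ))
    (hW : IsClosedWalk k f) (hA : IsProperAssignment k f A)
    (m : ℕ) (g : ℤ → ℤ × ℤ) (hC : IsElemCycleWalk k f A m g) :
    IsRightTurnWalk g := by
  rcases hC with ⟨E, -, rfl⟩ | ⟨-, hno, -, rfl⟩
  · exact E.isRightTurnWalk hW hA
  · exact isRightTurnWalk_of_triples fun i => hW.rightTurnTriple_of_not_isPAIndex (hno _)

end Hex
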